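/- Assume (A1) and (A2). For every μ_x ∈ P₂(ℝ^{d_x}) there exists a unique μ_z^* ∈ P₂(ℝ^{d_z}) such that 𝓕₁(μ_x, μ_z^*) ≤ 𝓕₁(μ_x, ν) for all ν ∈ P₂(ℝ^{d_z}); moreover 𝓕₁(μ_x, μ_z^*) is finite and μ_z^* is absolutely continuous with respect to Lebesgue measure on ℝ^{d_z}. -/

import Mathlib

open MeasureTheory ProbabilityTheory Real Filter
open scoped ENNReal Classical

noncomputable section

/-- `Euc d` is Euclidean space `ℝ^d`. -/
abbrev Euc (d : ℕ) : Type := EuclideanSpace ℝ (Fin d)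

/-- `P₂(ℝ^d)`: Borel probability measures with finite second moment. -/
def IsP2 {d : ℕ} (μ : Measure (Euc d)) : Prop :=
  IsProbabilityMeasure μ ∧ Integrable (fun x => ‖x‖ ^ 2) μ

/-- Negative entropy of a probability measure, valued in `ℝ ∪ {+∞}` (as `EReal`):
the integral `∫ log(dμ/dLeb) dμ` if `μ` is absolutely continuous w.r.t. Lebesgue measure
and that integral exists in `ℝ`, and `+∞` otherwise. -/
def Ent {d : ℕ} (μ : Measure (Euc d)) : EReal :=
  if μ ≪ (volume : Measure (Euc d)) ∧
      Integrable (fun x => Real.log (μ.rnDeriv volume x).toReal) μ then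
    ((∫ x, Real.log (μ.rnDeriv volume x).toReal ∂μ : ℝ) : EReal)
  else ⊤

/-- Kullback–Leibler divergence `KL(ν, μ)`, valued in `ℝ ∪ {+∞}` (as `EReal`). -/
def KL {α : Type*} [MeasurableSpace α] (ν μ : Measure α) : EReal :=
  if ν ≪ μ ∧ Integrable (fun x => Real.log (ν.rnDeriv μ x).toReal) ν then
    ((∫ x, Real.log (ν.rnDeriv μ x).toReal ∂ν : ℝ) : EReal)
  else ⊤

section Setting

variable {da dw dx dz : ℕ}

/-- Stage-I unregularized objective `U₁`. -/
def U1 (ρ : Measure (Euc da × Euc dw × ℝ)) (ΨA : Euc da → Euc dx → ℝ)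
    (ΨW : Euc dw → Euc dz → ℝ) (μx : Measure (Euc dx)) (μz : Measure (Euc dz)) : ℝ :=
  (1 / 2) * ∫ p, ((∫ z, ΨW p.2.1 z ∂μz) - (∫ x, ΨA p.1 x ∂μx)) ^ 2 ∂ρ

/-- Stage-II unregularized objective `U₂`. -/
def U2 (ρ : Measure (Euc da × Euc dw × ℝ)) (ΨW : Euc dw → Euc dz → ℝ)
    (μz : Measure (Euc dz)) : ℝ :=
  (1 / 2) * ∫ p, ((∫ z, ΨW p.2.1 z ∂μz) - p.2.2) ^ 2 ∂ρ

/-- `F₁ = U₁ + (ζ₁/2)·second moment of μ_z`. -/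
def F1 (ρ : Measure (Euc da × Euc dw × ℝ)) (ΨA : Euc da → Euc dx → ℝ)
    (ΨW : Euc dw → Euc dz → ℝ) (ζ1 : ℝ) (μx : Measure (Euc dx)) (μz : Measure (Euc dz)) : ℝ :=
  U1 ρ ΨA ΨW μx μz + (ζ1 / 2) * ∫ z, ‖z‖ ^ 2 ∂μz

/-- `F₂ = U₂ + (ζ₂/2)·second moment of μ_x`. -/
def F2 (ρ : Measure (Euc da × Euc dw × ℝ)) (ΨW : Euc dw → Euc dz → ℝ) (ζ2 : ℝ)
    (μx : Measure (Euc dx)) (μz : Measure (Euc dz)) : ℝ :=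
  U2 ρ ΨW μz + (ζ2 / 2) * ∫ x, ‖x‖ ^ 2 ∂μx

/-- `𝓕₁ = F₁ + σ₁·Ent(μ_z)`, valued in `ℝ ∪ {+∞}`. -/
def calF1 (ρ : Measure (Euc da × Euc dw × ℝ)) (ΨA : Euc da → Euc dx → ℝ)
    (ΨW : Euc dw → Euc dz → ℝ) (ζ1 σ1 : ℝ) (μx : Measure (Euc dx))
    (μz : Measure (Euc dz)) : EReal :=
  ((F1 ρ ΨA ΨW ζ1 μx μz : ℝ) : EReal) + (σ1 : EReal) * Ent μz

/-- `𝓕₂ = F₂ + σ₂·Ent(μ_x)`, valued in `ℝ ∪ {+∞}`. -/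
def calF2 (ρ : Measure (Euc da × Euc dw × ℝ)) (ΨW : Euc dw → Euc dz → ℝ) (ζ2 σ2 : ℝ)
    (μx : Measure (Euc dx)) (μz : Measure (Euc dz)) : EReal :=
  ((F2 ρ ΨW ζ2 μx μz : ℝ) : EReal) + (σ2 : EReal) * Ent μx

/-- Assumption (A1): bounded target, `|y| ≤ M` for `ρ`-a.e. `(𝐚, 𝐰, y)`. -/
def A1 (ρ : Measure (Euc da × Euc dw × ℝ)) (M : ℝ) : Prop :=
  ∀ᵐ p ∂ρ, |p.2.2| ≤ M

/-- Assumption (A2): jointly measurable, bounded and smooth networks with bounded gradients. -/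
def A2 (ΨA : Euc da → Euc dx → ℝ) (ΨW : Euc dw → Euc dz → ℝ) (R : ℝ) : Prop :=
  Measurable (Function.uncurry ΨA) ∧ Measurable (Function.uncurry ΨW) ∧
    (∀ a x, |ΨA a x| ≤ R) ∧ (∀ w z, |ΨW w z| ≤ R) ∧
    (∀ a, Differentiable ℝ (ΨA a)) ∧ (∀ a x, ‖fderiv ℝ (ΨA a) x‖ ≤ R) ∧
    (∀ w, Differentiable ℝ (ΨW w)) ∧ (∀ w z, ‖fderiv ℝ (ΨW w) z‖ ≤ R)

/-- A Stage-I selection: to each `μ_x ∈ P₂` it assigns a global minimizer of `𝓕₁(μ_x, ·)`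
over `P₂(ℝ^{d_z})`, with finite value. -/
def IsStageOneSel (ρ : Measure (Euc da × Euc dw × ℝ)) (ΨA : Euc da → Euc dx → ℝ)
    (ΨW : Euc dw → Euc dz → ℝ) (ζ1 σ1 : ℝ)
    (sel : Measure (Euc dx) → Measure (Euc dz)) : Prop :=
  ∀ μx, IsP2 μx →
    IsP2 (sel μx) ∧ calF1 ρ ΨA ΨW ζ1 σ1 μx (sel μx) ≠ ⊤ ∧
      calF1 ρ ΨA ΨW ζ1 σ1 μx (sel μx) ≠ ⊥ ∧
      ∀ ν, IsP2 ν → calF1 ρ ΨA ΨW ζ1 σ1 μx (sel μx) ≤ calF1 ρ ΨA ΨW ζ1 σ1 μx ν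

/-- The Lagrangian `𝓛_λ(μ_x, μ_z) = 𝓕₂(μ_x, μ_z) + λ(𝓕₁(μ_x, μ_z) − 𝓕₁(μ_x, μ_z^*(μ_x)))`. -/
def Lag (ρ : Measure (Euc da × Euc dw × ℝ)) (ΨA : Euc da → Euc dx → ℝ)
    (ΨW : Euc dw → Euc dz → ℝ) (ζ1 ζ2 σ1 σ2 : ℝ)
    (sel : Measure (Euc dx) → Measure (Euc dz)) (lam : ℝ)
    (μx : Measure (Euc dx)) (μz : Measure (Euc dz)) : EReal :=
  calF2 ρ ΨW ζ2 σ2 μx μz +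
    (lam : EReal) * (calF1 ρ ΨA ΨW ζ1 σ1 μx μz - calF1 ρ ΨA ΨW ζ1 σ1 μx (sel μx))

end Setting

open InformationTheory
open scoped Topology

lemma two_mul_sub_sqrt_mul_sqrt_le {x m : ℝ} (hx : 0 ≤ x) (hm : 0 < m) :
    2 * x - 2 * (√x * √m) ≤ x * log x - x * log m := by
  rcases hx.eq_or_lt with rfl | hx
  · simp
  have hsx : 0 < √x := Real.sqrt_pos.2 hx
  have hsm : 0 < √m := Real.sqrt_pos.2 hm
  have h := Real.log_le_sub_one_of_pos (div_pos hsm hsx)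
  rw [Real.log_div hsm.ne' hsx.ne', Real.log_sqrt hm.le, Real.log_sqrt hx.le] at h
  have h2 := mul_le_mul_of_nonneg_left h (mul_nonneg zero_le_two hx.le)
  have h3 : 2 * x * (√m / √x - 1) = 2 * (√x * √m) - 2 * x := by
    have : x = √x * √x := (Real.mul_self_sqrt hx.le).symm
    field_simp
    nlinarith
  rw [h3] at h2
  linarith

/-- Quantitative midpoint convexity of `klFun`. -/
lemma klFun_midpoint_add_le {x y : ℝ} (hx : 0 ≤ x) (hy : 0 ≤ y) (t : ℝ) :
    2 * klFun ((x + y) / 2) + (t * |x - y| - t ^ 2 * (x + y)) ≤ klFun x + klFun y := by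
  rcases (add_nonneg hx hy).eq_or_lt with h0 | hpos
  · have hx0 : x = 0 := by linarith
    have hy0 : y = 0 := by linarith
    subst hx0 hy0
    simp only [klFun_apply]
    norm_num
  have hm : 0 < (x + y) / 2 := by linarith
  have h1 := two_mul_sub_sqrt_mul_sqrt_le hx hm
  have h2 := two_mul_sub_sqrt_mul_sqrt_le hy hm
  simp only [klFun_apply]
  set c := √((x + y) / 2)
  have hc : c ^ 2 = (x + y) / 2 := Real.sq_sqrt hm.le
  have ha : √x ^ 2 = x := Real.sq_sqrt hx
  have hb : √y ^ 2 = y := Real.sq_sqrt hy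
  have ha0 := Real.sqrt_nonneg x
  have hb0 := Real.sqrt_nonneg y
  have habs : |x - y| = |√x - √y| * (√x + √y) := by
    rw [← abs_of_nonneg (add_nonneg ha0 hb0), ← abs_mul]
    congr 1
    nlinarith
  have hsq : |√x - √y| ^ 2 = (√x - √y) ^ 2 := sq_abs _
  rw [habs]
  nlinarith [sq_nonneg (2 * c - (√x + √y)), sq_nonneg (|√x - √y| - t * (√x + √y)),
    sq_nonneg (t * (√x - √y))]

section DirectMethod

variable {α : Type*} [MeasurableSpace α]

/-- `f` is a (pointwise nonnegative) probability density with respect to `γ`. -/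
structure IsProbDensity (γ : Measure α) (f : α → ℝ) : Prop where
  measurable : Measurable f
  nonneg : ∀ x, 0 ≤ f x
  integrable : Integrable f γ
  integral_eq_one : ∫ x, f x ∂γ = 1

lemma IsProbDensity.midpoint {γ : Measure α} {f g : α → ℝ} (hf : IsProbDensity γ f)
    (hg : IsProbDensity γ g) : IsProbDensity γ fun x => (f x + g x) / 2 where
  measurable := (hf.measurable.add hg.measurable).div_const 2
  nonneg x := by have := hf.nonneg x; have := hg.nonneg x; positivity
  integrable := (hf.integrable.add hg.integrable).div_const 2
  integral_eq_one := by
    rw [integral_div, integral_add hf.integrable hg.integrable, hf.integral_eq_one,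
      hg.integral_eq_one]
    norm_num

/-- A functional of a density penalised by its relative entropy with respect to `γ`. -/
def entropicObjective (γ : Measure α) (V : (α → ℝ) → ℝ) (σ : ℝ) (f : α → ℝ) : ℝ :=
  V f + σ * ∫ x, klFun (f x) ∂γ

variable {γ : Measure α} {f g : α → ℝ}

lemma IsProbDensity.integrable_klFun_midpoint (hf : IsProbDensity γ f) (hg : IsProbDensity γ g)
    (hfi : Integrable (fun x => klFun (f x)) γ) (hgi : Integrable (fun x => klFun (g x)) γ) :
    Integrable (fun x => klFun ((f x + g x) / 2)) γ := by
  refine (hfi.add hgi).mono'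
    (measurable_klFun.comp (hf.midpoint hg).measurable).aestronglyMeasurable
    (.of_forall fun x => ?_)
  have h := klFun_midpoint_add_le (hf.nonneg x) (hg.nonneg x) 0
  have h0 := klFun_nonneg ((hf.midpoint hg).nonneg x)
  rw [Real.norm_of_nonneg h0]
  simp only [Pi.add_apply]
  linarith

lemma IsProbDensity.integral_klFun_midpoint_add_le (hf : IsProbDensity γ f)
    (hg : IsProbDensity γ g) (hfi : Integrable (fun x => klFun (f x)) γ)
    (hgi : Integrable (fun x => klFun (g x)) γ) (t : ℝ) :
    2 * ∫ x, klFun ((f x + g x) / 2) ∂γ + (t * ∫ x, |f x - g x| ∂γ - 2 * t ^ 2)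
      ≤ ∫ x, klFun (f x) ∂γ + ∫ x, klFun (g x) ∂γ := by
  have hmi := hf.integrable_klFun_midpoint hg hfi hgi
  have hd : Integrable (fun x => |f x - g x|) γ := (hf.integrable.sub hg.integrable).abs
  have hs : Integrable (fun x => f x + g x) γ := hf.integrable.add hg.integrable
  have hds : Integrable (fun x => t * |f x - g x| - t ^ 2 * (f x + g x)) γ :=
    (hd.const_mul t).sub (hs.const_mul (t ^ 2))
  have h := integral_mono ((hmi.const_mul 2).add hds)
    (hfi.add hgi) fun x => klFun_midpoint_add_le (hf.nonneg x) (hg.nonneg x) t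
  simp only [Pi.add_apply] at h
  rw [integral_add (hmi.const_mul 2) hds,
    integral_sub (hd.const_mul t) (hs.const_mul (t ^ 2)), integral_add hfi hgi,
    integral_const_mul, integral_const_mul, integral_const_mul,
    integral_add hf.integrable hg.integrable, hf.integral_eq_one, hg.integral_eq_one] at h
  linarith

/-- Near-minimisers of an entropic objective are close in `L¹`. -/
lemma IsProbDensity.integral_abs_sub_le_of_near_min {V : (α → ℝ) → ℝ} {σ m δ : ℝ} (hσ : 0 < σ)
    (hV : ∀ f g, IsProbDensity γ f → IsProbDensity γ g →
      2 * V (fun x => (f x + g x) / 2) ≤ V f + V g)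
    (hm : ∀ h, IsProbDensity γ h → Integrable (fun x => klFun (h x)) γ →
      m ≤ entropicObjective γ V σ h)
    (hf : IsProbDensity γ f) (hg : IsProbDensity γ g)
    (hfi : Integrable (fun x => klFun (f x)) γ) (hgi : Integrable (fun x => klFun (g x)) γ)
    (hfm : entropicObjective γ V σ f ≤ m + δ) (hgm : entropicObjective γ V σ g ≤ m + δ) (t : ℝ) :
    σ * (t * ∫ x, |f x - g x| ∂γ - 2 * t ^ 2) ≤ 2 * δ := by
  have h1 := hm _ (hf.midpoint hg) (hf.integrable_klFun_midpoint hg hfi hgi)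
  have h2 := mul_le_mul_of_nonneg_left
    (hf.integral_klFun_midpoint_add_le hg hfi hgi t) hσ.le
  have h3 := hV f g hf hg
  unfold entropicObjective at *
  linarith

lemma IsProbDensity.ae_eq_of_minimizers {V : (α → ℝ) → ℝ} {σ m : ℝ} (hσ : 0 < σ)
    (hV : ∀ f g, IsProbDensity γ f → IsProbDensity γ g →
      2 * V (fun x => (f x + g x) / 2) ≤ V f + V g)
    (hm : ∀ h, IsProbDensity γ h → Integrable (fun x => klFun (h x)) γ →
      m ≤ entropicObjective γ V σ h)
    (hf : IsProbDensity γ f) (hg : IsProbDensity γ g)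
    (hfi : Integrable (fun x => klFun (f x)) γ) (hgi : Integrable (fun x => klFun (g x)) γ)
    (hfm : entropicObjective γ V σ f ≤ m) (hgm : entropicObjective γ V σ g ≤ m) :
    f =ᵐ[γ] g := by
  have hd : Integrable (fun x => |f x - g x|) γ := (hf.integrable.sub hg.integrable).abs
  have hnn : 0 ≤ ∫ x, |f x - g x| ∂γ := integral_nonneg fun x => abs_nonneg _
  have h := hf.integral_abs_sub_le_of_near_min hσ hV hm hg hfi hgi (δ := 0)
    (by simpa using hfm) (by simpa using hgm) ((∫ x, |f x - g x| ∂γ) / 4)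
  have h0 : ∫ x, |f x - g x| ∂γ = 0 := by
    by_contra hne
    have hpos : 0 < ∫ x, |f x - g x| ∂γ := lt_of_le_of_ne hnn (Ne.symm hne)
    nlinarith [mul_pos hσ (mul_pos hpos hpos)]
  rw [integral_eq_zero_iff_of_nonneg (fun x => abs_nonneg _) hd] at h0
  filter_upwards [h0] with x hx
  simpa [sub_eq_zero] using hx

lemma eLpNorm_sub_one_eq_ofReal (hf : Integrable f γ) (hg : Integrable g γ) :
    eLpNorm (f - g) 1 γ = ENNReal.ofReal (∫ x, |f x - g x| ∂γ) := by
  rw [eLpNorm_one_eq_lintegral_enorm, ← ofReal_integral_norm_eq_lintegral_enorm (hf.sub hg)]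
  rfl

/-- An `L¹`-limit of probability densities is a.e. equal to a probability density. -/
lemma IsProbDensity.exists_limit {u : ℕ → α → ℝ} (hu : ∀ n, IsProbDensity γ (u n))
    (hcau : ∀ N n m : ℕ, N ≤ n → N ≤ m → ∫ x, |u n x - u m x| ∂γ < (1 / 2 : ℝ) ^ N) :
    ∃ f, IsProbDensity γ f ∧ Tendsto (fun n => ∫ x, |u n x - f x| ∂γ) atTop (𝓝 0) ∧
      ∃ ns : ℕ → ℕ, StrictMono ns ∧
        ∀ᵐ x ∂γ, Tendsto (fun i => u (ns i) x) atTop (𝓝 (f x)) := by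
  obtain ⟨f₀, hf₀, hlim⟩ := Lp.cauchy_complete_eLpNorm (μ := γ) (p := 1) le_rfl
    (fun n => memLp_one_iff_integrable.2 (hu n).integrable)
    (B := fun N => ENNReal.ofReal ((1 / 2 : ℝ) ^ N))
    (summable_geometric_two).tsum_ofReal_ne_top
    (fun N n m hn hm => by
      rw [eLpNorm_sub_one_eq_ofReal (hu n).integrable (hu m).integrable]
      exact (ENNReal.ofReal_lt_ofReal_iff (by positivity)).2 (hcau N n m hn hm))
  obtain ⟨ns, hns, hae⟩ := (tendstoInMeasure_of_tendsto_eLpNorm one_ne_zero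
    (fun n => (hu n).measurable.aestronglyMeasurable) hf₀.aestronglyMeasurable
    hlim).exists_seq_tendsto_ae
  have hmk := hf₀.aestronglyMeasurable.ae_eq_mk
  have heq : f₀ =ᵐ[γ] fun x => max (hf₀.aestronglyMeasurable.mk f₀ x) 0 := by
    filter_upwards [hae, hmk] with x hx hxm
    rw [← hxm, max_eq_left]
    exact ge_of_tendsto' hx fun i => (hu _).nonneg x
  set f : α → ℝ := fun x => max (hf₀.aestronglyMeasurable.mk f₀ x) 0
  have hfi : Integrable f γ := (memLp_one_iff_integrable.1 hf₀).congr heq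
  have hL : Tendsto (fun n => ∫ x, |u n x - f x| ∂γ) atTop (𝓝 0) := by
    have h1 : Tendsto (fun n => (eLpNorm (u n - f₀) 1 γ).toReal) atTop (𝓝 0) := by
      simpa [Function.comp_def] using (ENNReal.tendsto_toReal ENNReal.zero_ne_top).comp hlim
    refine h1.congr fun n => ?_
    rw [eLpNorm_congr_ae (EventuallyEq.rfl.sub heq), eLpNorm_sub_one_eq_ofReal (hu n).integrable hfi,
      ENNReal.toReal_ofReal (integral_nonneg fun x => abs_nonneg _)]
  refine ⟨f, ⟨hf₀.aestronglyMeasurable.stronglyMeasurable_mk.measurable.max measurable_const,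
    fun x => le_max_right _ _, hfi, ?_⟩, hL, ns, hns, ?_⟩
  · have h2 : Tendsto (fun n => ∫ x, u n x ∂γ) atTop (𝓝 (∫ x, f x ∂γ)) := by
      rw [tendsto_iff_norm_sub_tendsto_zero]
      refine squeeze_zero (fun n => norm_nonneg _) (fun n => ?_) hL
      rw [← integral_sub (hu n).integrable hfi]
      exact norm_integral_le_integral_norm _
    simp only [(hu _).integral_eq_one] at h2
    exact tendsto_nhds_unique h2 tendsto_const_nhds
  · filter_upwards [hae, heq] with x hx hxe
    rwa [← hxe]

/-- Direct method: an entropic objective attains its minimum over probability densities. -/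
lemma exists_entropicObjective_minimizer [IsFiniteMeasure γ] [NeZero γ] {V : (α → ℝ) → ℝ} {σ C : ℝ} (hσ : 0 < σ)
    (hV0 : ∀ f, 0 ≤ V f)
    (hV : ∀ f g, IsProbDensity γ f → IsProbDensity γ g →
      2 * V (fun x => (f x + g x) / 2) ≤ V f + V g)
    (hVlip : ∀ f g, IsProbDensity γ f → IsProbDensity γ g →
      |V f - V g| ≤ C * ∫ x, |f x - g x| ∂γ) :
    ∃ f, IsProbDensity γ f ∧ Integrable (fun x => klFun (f x)) γ ∧
      ∀ h, IsProbDensity γ h → Integrable (fun x => klFun (h x)) γ →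
        entropicObjective γ V σ f ≤ entropicObjective γ V σ h := by
  set S : Set ℝ := {r | ∃ h, IsProbDensity γ h ∧ Integrable (fun x => klFun (h x)) γ ∧
    entropicObjective γ V σ h = r} with hS
  have hSne : S.Nonempty := by
    refine ⟨_, fun _ => (γ.real Set.univ)⁻¹, ⟨measurable_const, fun x => by positivity,
      integrable_const _, ?_⟩, integrable_const _, rfl⟩
    have : γ.real Set.univ ≠ 0 := by simp [Measure.real, ENNReal.toReal_eq_zero_iff, NeZero.ne]
    simp [this]
  have hSbdd : BddBelow S := by
    refine ⟨0, ?_⟩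
    rintro _ ⟨h, hh, hhi, rfl⟩
    exact add_nonneg (hV0 h) (mul_nonneg hσ.le
      (integral_nonneg fun x => klFun_nonneg (hh.nonneg x)))
  set m := sInf S
  have hm : ∀ h, IsProbDensity γ h → Integrable (fun x => klFun (h x)) γ →
      m ≤ entropicObjective γ V σ h := fun h hh hhi => csInf_le hSbdd ⟨h, hh, hhi, rfl⟩
  set t : ℕ → ℝ := fun N => (1 / 2 : ℝ) ^ N / 8
  have ht : ∀ N, 0 < t N := fun N => by positivity
  have hseq : ∀ N, ∃ h, IsProbDensity γ h ∧ Integrable (fun x => klFun (h x)) γ ∧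
      entropicObjective γ V σ h < m + σ * t N ^ 2 := fun N => by
    obtain ⟨_, ⟨h, hh, hhi, rfl⟩, hlt⟩ := exists_lt_of_csInf_lt hSne
      (lt_add_of_pos_right m (mul_pos hσ (pow_pos (ht N) 2)))
    exact ⟨h, hh, hhi, hlt⟩
  choose u hu hui hum using hseq
  have ht_anti : ∀ N n, N ≤ n → t n ≤ t N := fun N n hn => by
    have := pow_le_pow_of_le_one (by norm_num : (0 : ℝ) ≤ 1 / 2) (by norm_num) hn
    simp only [t]
    linarith
  have hnear : ∀ N n, N ≤ n → entropicObjective γ V σ (u n) ≤ m + σ * t N ^ 2 := fun N n hn => by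
    have := mul_le_mul_of_nonneg_left (pow_le_pow_left₀ (ht n).le (ht_anti N n hn) 2) hσ.le
    linarith [hum n]
  obtain ⟨f, hf, hL, ns, hns, hae⟩ := IsProbDensity.exists_limit hu fun N n k hn hk => by
    have h := (hu n).integral_abs_sub_le_of_near_min hσ hV hm (hu k) (hui n) (hui k)
      (hnear N n hn) (hnear N k hk) (t N)
    have h4 : ∫ x, |u n x - u k x| ∂γ ≤ 4 * t N := by
      have h5 : σ * t N * ∫ x, |u n x - u k x| ∂γ ≤ σ * t N * (4 * t N) := by linarith
      exact le_of_mul_le_mul_left h5 (mul_pos hσ (ht N))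
    have h6 : (0 : ℝ) < (1 / 2) ^ N := by positivity
    refine h4.trans_lt ?_
    simp only [t]
    linarith
  have hJ : Tendsto (fun n => entropicObjective γ V σ (u n)) atTop (𝓝 m) := by
    refine tendsto_of_tendsto_of_tendsto_of_le_of_le tendsto_const_nhds ?_
      (fun n => hm _ (hu n) (hui n)) fun n => (hum n).le
    have h0 : Tendsto t atTop (𝓝 0) := by
      simpa [t] using (tendsto_pow_atTop_nhds_zero_of_lt_one (by norm_num : (0 : ℝ) ≤ 1 / 2)
        (by norm_num)).div_const 8
    simpa using ((h0.pow 2).const_mul σ).const_add m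
  have hVt : Tendsto (fun n => V (u n)) atTop (𝓝 (V f)) := by
    rw [tendsto_iff_norm_sub_tendsto_zero]
    refine squeeze_zero (fun n => norm_nonneg _) (fun n => hVlip _ _ (hu n) hf) ?_
    simpa using hL.const_mul C
  have hK : Tendsto (fun n => ∫ x, klFun (u n x) ∂γ) atTop (𝓝 ((m - V f) / σ)) := by
    refine ((hJ.sub hVt).div_const σ).congr fun n => ?_
    simp only [entropicObjective]
    field_simp
    ring
  have hK0 : 0 ≤ (m - V f) / σ :=
    ge_of_tendsto' hK fun n => integral_nonneg fun x => klFun_nonneg ((hu n).nonneg x)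
  have hfatou : ∫⁻ x, ENNReal.ofReal (klFun (f x)) ∂γ ≤ ENNReal.ofReal ((m - V f) / σ) := by
    calc ∫⁻ x, ENNReal.ofReal (klFun (f x)) ∂γ
        = ∫⁻ x, liminf (fun i => ENNReal.ofReal (klFun (u (ns i) x))) atTop ∂γ := by
          refine lintegral_congr_ae ?_
          filter_upwards [hae] with x hx
          exact (((ENNReal.continuous_ofReal.comp continuous_klFun).tendsto _).comp
            hx).liminf_eq.symm
      _ ≤ liminf (fun i => ∫⁻ x, ENNReal.ofReal (klFun (u (ns i) x)) ∂γ) atTop :=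
          lintegral_liminf_le fun i =>
            (measurable_klFun.comp (hu _).measurable).ennreal_ofReal
      _ = ENNReal.ofReal ((m - V f) / σ) := by
          refine Tendsto.liminf_eq ?_
          refine ((ENNReal.tendsto_ofReal hK).comp hns.tendsto_atTop).congr fun i => ?_
          exact ofReal_integral_eq_lintegral_ofReal (hui _)
            (.of_forall fun x => klFun_nonneg ((hu _).nonneg x))
  have hkm : Measurable fun x => klFun (f x) := measurable_klFun.comp hf.measurable
  have hknn : 0 ≤ᵐ[γ] fun x => klFun (f x) := .of_forall fun x => klFun_nonneg (hf.nonneg x)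
  have hfi : Integrable (fun x => klFun (f x)) γ :=
    ⟨hkm.aestronglyMeasurable, (hasFiniteIntegral_iff_ofReal hknn).2
      (hfatou.trans_lt ENNReal.ofReal_lt_top)⟩
  refine ⟨f, hf, hfi, fun h hh hhi => le_trans ?_ (hm h hh hhi)⟩
  rw [← ofReal_integral_eq_lintegral_ofReal hfi hknn, ENNReal.ofReal_le_ofReal_iff hK0,
    le_div_iff₀ hσ] at hfatou
  simp only [entropicObjective]
  linarith

end DirectMethod

section QuadraticRisk

variable {α Ω : Type*} [MeasurableSpace α] [MeasurableSpace Ω]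

/-- The quadratic risk of the mean-field model `p ↦ ∫ f z * Ψ p z ∂γ` with target `c`. -/
def quadRisk (ρ : Measure Ω) (γ : Measure α) (Ψ : Ω → α → ℝ) (c : Ω → ℝ) (f : α → ℝ) : ℝ :=
  (1 / 2) * ∫ p, ((∫ z, f z * Ψ p z ∂γ) - c p) ^ 2 ∂ρ

variable {ρ : Measure Ω} {γ : Measure α} {Ψ : Ω → α → ℝ} {c : Ω → ℝ} {R : ℝ} {f g : α → ℝ}

lemma quadRisk_nonneg (f : α → ℝ) : 0 ≤ quadRisk ρ γ Ψ c f :=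
  mul_nonneg (by norm_num) (integral_nonneg fun _ => sq_nonneg _)

lemma quadRisk_congr (h : f =ᵐ[γ] g) : quadRisk ρ γ Ψ c f = quadRisk ρ γ Ψ c g := by
  unfold quadRisk
  congr 2 with p
  rw [integral_congr_ae (g := fun z => g z * Ψ p z)]
  filter_upwards [h] with z hz
  rw [hz]

lemma integrable_mul_of_bounded (hΨ : Measurable (Function.uncurry Ψ))
    (hΨR : ∀ p z, |Ψ p z| ≤ R) (hf : Integrable f γ) (p : Ω) :
    Integrable (fun z => f z * Ψ p z) γ :=
  hf.mul_bdd (c := R) (hΨ.of_uncurry_left).aestronglyMeasurable (.of_forall fun z => hΨR p z)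

lemma abs_integral_mul_le (hΨR : ∀ p z, |Ψ p z| ≤ R) (hf : Integrable f γ) (p : Ω) :
    |∫ z, f z * Ψ p z ∂γ| ≤ R * ∫ z, |f z| ∂γ := by
  rw [← integral_const_mul, ← Real.norm_eq_abs]
  refine norm_integral_le_of_norm_le (hf.abs.const_mul R) (.of_forall fun z => ?_)
  rw [Real.norm_eq_abs, abs_mul, mul_comm]
  exact mul_le_mul_of_nonneg_right (hΨR p z) (abs_nonneg _)

lemma IsProbDensity.abs_residual_le (hΨR : ∀ p z, |Ψ p z| ≤ R) (hcR : ∀ p, |c p| ≤ R)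
    (hf : IsProbDensity γ f) (p : Ω) : |(∫ z, f z * Ψ p z ∂γ) - c p| ≤ 2 * R := by
  have h := abs_integral_mul_le hΨR hf.integrable p
  simp only [abs_of_nonneg (hf.nonneg _), hf.integral_eq_one] at h
  have h2 := abs_sub (∫ z, f z * Ψ p z ∂γ) (c p)
  linarith [hcR p]

lemma measurable_residual [SFinite γ] (hΨ : Measurable (Function.uncurry Ψ)) (hc : Measurable c)
    (hf : Measurable f) : Measurable fun p => (∫ z, f z * Ψ p z ∂γ) - c p := by
  refine Measurable.sub ?_ hc
  have h : StronglyMeasurable (Function.uncurry fun (p : Ω) (z : α) => f z * Ψ p z) :=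
    ((hf.comp measurable_snd).mul hΨ).stronglyMeasurable
  exact h.integral_prod_right.measurable

lemma IsProbDensity.integrable_residual_sq [IsFiniteMeasure ρ] [SFinite γ]
    (hΨ : Measurable (Function.uncurry Ψ)) (hΨR : ∀ p z, |Ψ p z| ≤ R) (hc : Measurable c)
    (hcR : ∀ p, |c p| ≤ R) (hf : IsProbDensity γ f) :
    Integrable (fun p => ((∫ z, f z * Ψ p z ∂γ) - c p) ^ 2) ρ := by
  refine Integrable.of_bound ((measurable_residual hΨ hc hf.measurable).pow_const
    2).aestronglyMeasurable ((2 * R) ^ 2) (.of_forall fun p => ?_)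
  rw [Real.norm_eq_abs, abs_pow]
  exact pow_le_pow_left₀ (abs_nonneg _) (hf.abs_residual_le hΨR hcR p) 2

lemma two_mul_quadRisk_midpoint_le [IsFiniteMeasure ρ] [SFinite γ]
    (hΨ : Measurable (Function.uncurry Ψ)) (hΨR : ∀ p z, |Ψ p z| ≤ R) (hc : Measurable c)
    (hcR : ∀ p, |c p| ≤ R) (hf : IsProbDensity γ f) (hg : IsProbDensity γ g) :
    2 * quadRisk ρ γ Ψ c (fun x => (f x + g x) / 2)
      ≤ quadRisk ρ γ Ψ c f + quadRisk ρ γ Ψ c g := by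
  have hfs := hf.integrable_residual_sq (ρ := ρ) hΨ hΨR hc hcR
  have hgs := hg.integrable_residual_sq (ρ := ρ) hΨ hΨR hc hcR
  have hms := (hf.midpoint hg).integrable_residual_sq (ρ := ρ) hΨ hΨR hc hcR
  have h := integral_mono (hms.const_mul 2) (hfs.add hgs) fun p => by
    have hp : ∫ z, (f z + g z) / 2 * Ψ p z ∂γ
        = ((∫ z, f z * Ψ p z ∂γ) + ∫ z, g z * Ψ p z ∂γ) / 2 := by
      rw [← integral_add (integrable_mul_of_bounded hΨ hΨR hf.integrable p)
        (integrable_mul_of_bounded hΨ hΨR hg.integrable p), ← integral_div]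
      congr 1 with z
      ring
    simp only [Pi.add_apply, hp]
    nlinarith [sq_nonneg ((∫ z, f z * Ψ p z ∂γ) - ∫ z, g z * Ψ p z ∂γ)]
  simp only [Pi.add_apply] at h
  rw [integral_const_mul, integral_add hfs hgs] at h
  unfold quadRisk
  linarith

lemma abs_quadRisk_sub_le [IsProbabilityMeasure ρ] [SFinite γ]
    (hΨ : Measurable (Function.uncurry Ψ)) (hΨR : ∀ p z, |Ψ p z| ≤ R) (hc : Measurable c)
    (hcR : ∀ p, |c p| ≤ R) (hf : IsProbDensity γ f) (hg : IsProbDensity γ g) :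
    |quadRisk ρ γ Ψ c f - quadRisk ρ γ Ψ c g| ≤ 2 * R ^ 2 * ∫ x, |f x - g x| ∂γ := by
  have hfs := hf.integrable_residual_sq (ρ := ρ) hΨ hΨR hc hcR
  have hgs := hg.integrable_residual_sq (ρ := ρ) hΨ hΨR hc hcR
  have hpt : ∀ p, ‖((∫ z, f z * Ψ p z ∂γ) - c p) ^ 2 - ((∫ z, g z * Ψ p z ∂γ) - c p) ^ 2‖
      ≤ 4 * R ^ 2 * ∫ x, |f x - g x| ∂γ := fun p => by
    have h1 := hf.abs_residual_le hΨR hcR p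
    have h2 := hg.abs_residual_le hΨR hcR p
    have h3 := abs_integral_mul_le hΨR (hf.integrable.sub hg.integrable) p
    simp only [Pi.sub_apply, sub_mul] at h3
    rw [integral_sub (integrable_mul_of_bounded hΨ hΨR hf.integrable p)
      (integrable_mul_of_bounded hΨ hΨR hg.integrable p)] at h3
    rw [sq_sub_sq, Real.norm_eq_abs, abs_mul, sub_sub_sub_cancel_right]
    have h4 := (abs_add_le ((∫ z, f z * Ψ p z ∂γ) - c p) ((∫ z, g z * Ψ p z ∂γ) - c p)).trans
      (add_le_add h1 h2)
    calc _ ≤ (2 * R + 2 * R) * (R * ∫ x, |f x - g x| ∂γ) :=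
          mul_le_mul h4 h3 (abs_nonneg _) ((abs_nonneg _).trans h4)
      _ = _ := by ring
  unfold quadRisk
  rw [← mul_sub, ← integral_sub hfs hgs, abs_mul]
  have h := norm_integral_le_of_norm_le_const (μ := ρ) (.of_forall hpt)
  rw [probReal_univ, mul_one, Real.norm_eq_abs] at h
  rw [abs_of_nonneg (by norm_num : (0 : ℝ) ≤ 1 / 2)]
  linarith

end QuadraticRisk

section Density

variable {α : Type*} [MeasurableSpace α] {μ γ : Measure α} {f : α → ℝ}

lemma isProbDensity_toReal_rnDeriv [IsProbabilityMeasure μ] [SigmaFinite γ] (h : μ ≪ γ) :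
    IsProbDensity γ fun x => (μ.rnDeriv γ x).toReal where
  measurable := (Measure.measurable_rnDeriv μ γ).ennreal_toReal
  nonneg _ := ENNReal.toReal_nonneg
  integrable := Measure.integrable_toReal_rnDeriv
  integral_eq_one := by rw [Measure.integral_toReal_rnDeriv h, probReal_univ]

lemma eq_of_toReal_rnDeriv_ae_eq {ν : Measure α} [IsFiniteMeasure μ] [IsFiniteMeasure ν]
    [SigmaFinite γ] (hμ : μ ≪ γ) (hν : ν ≪ γ)
    (h : (fun x => (μ.rnDeriv γ x).toReal) =ᵐ[γ] fun x => (ν.rnDeriv γ x).toReal) : μ = ν := by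
  rw [← Measure.withDensity_rnDeriv_eq μ γ hμ, ← Measure.withDensity_rnDeriv_eq ν γ hν]
  refine withDensity_congr_ae ?_
  filter_upwards [h, Measure.rnDeriv_ne_top μ γ, Measure.rnDeriv_ne_top ν γ] with x hx h1 h2
  exact (ENNReal.toReal_eq_toReal_iff' h1 h2).1 hx

lemma IsProbDensity.isProbabilityMeasure_withDensity (hf : IsProbDensity γ f) :
    IsProbabilityMeasure (γ.withDensity fun x => ENNReal.ofReal (f x)) := by
  constructor
  rw [withDensity_apply _ MeasurableSet.univ, Measure.restrict_univ,
    ← ofReal_integral_eq_lintegral_ofReal hf.integrable (.of_forall hf.nonneg),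
    hf.integral_eq_one, ENNReal.ofReal_one]

lemma IsProbDensity.toReal_rnDeriv_withDensity [SigmaFinite γ] (hf : IsProbDensity γ f) :
    (fun x => ((γ.withDensity fun x => ENNReal.ofReal (f x)).rnDeriv γ x).toReal) =ᵐ[γ] f := by
  filter_upwards [Measure.rnDeriv_withDensity γ hf.measurable.ennreal_ofReal] with x hx
  rw [hx, ENNReal.toReal_ofReal (hf.nonneg x)]

/-- Young's inequality for the entropy. -/
lemma mul_le_klFun_add_exp {x : ℝ} (hx : 0 ≤ x) (y : ℝ) : x * y ≤ klFun x + rexp y := by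
  rw [klFun_apply]
  rcases hx.eq_or_lt with rfl | hx
  · simp only [zero_mul, log_zero]
    linarith [Real.exp_pos y]
  · have h := mul_le_mul_of_nonneg_left (Real.add_one_le_exp (y - Real.log x)) hx.le
    rw [Real.exp_sub, Real.exp_log hx, mul_div_cancel₀ _ hx.ne'] at h
    linarith

end Density

section GaussianReference

variable {d : ℕ} {b : ℝ}

lemma integrable_exp_neg_mul_norm_sq (hb : 0 < b) :
    Integrable fun z : Euc d => rexp (-b * ‖z‖ ^ 2) := by
  have h := (GaussianFourier.integrable_cexp_neg_mul_sq_norm_add (V := Euc d) (b := (b : ℂ))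
    (by simpa using hb) 0 0).norm
  refine h.congr (.of_forall fun z => ?_)
  simp only [Complex.norm_exp]
  congr 1
  norm_cast
  simp

/-- The centred Gaussian probability measure with density proportional to `exp (-b ‖z‖²)`. -/
def gaussianRef (d : ℕ) (b : ℝ) : Measure (Euc d) :=
  (volume : Measure (Euc d)).tilted fun z => -b * ‖z‖ ^ 2

lemma isProbabilityMeasure_gaussianRef (hb : 0 < b) : IsProbabilityMeasure (gaussianRef d b) :=
  isProbabilityMeasure_tilted (integrable_exp_neg_mul_norm_sq hb)

lemma volume_absolutelyContinuous_gaussianRef (hb : 0 < b) : volume ≪ gaussianRef d b :=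
  absolutelyContinuous_tilted (integrable_exp_neg_mul_norm_sq hb)

lemma gaussianRef_absolutelyContinuous_volume : gaussianRef d b ≪ volume :=
  tilted_absolutelyContinuous _ _

lemma IsProbDensity.integrable_mul_norm_sq {f : Euc d → ℝ} (hb : 0 < b)
    (hf : IsProbDensity (gaussianRef d b) f)
    (hfi : Integrable (fun z => klFun (f z)) (gaussianRef d b)) :
    Integrable (fun z => f z * ‖z‖ ^ 2) (gaussianRef d b) := by
  have hexp : Integrable (fun z : Euc d => rexp (b / 2 * ‖z‖ ^ 2)) (gaussianRef d b) := by
    rw [gaussianRef, integrable_tilted_iff (integrable_exp_neg_mul_norm_sq hb)]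
    refine (integrable_exp_neg_mul_norm_sq (half_pos hb)).congr (.of_forall fun z => ?_)
    simp only [smul_eq_mul, ← Real.exp_add]
    congr 1
    ring
  refine ((hfi.add hexp).const_mul (2 / b)).mono'
    (hf.measurable.mul (by fun_prop)).aestronglyMeasurable (.of_forall fun z => ?_)
  have h := mul_le_mul_of_nonneg_left
    (mul_le_klFun_add_exp (hf.nonneg z) (b / 2 * ‖z‖ ^ 2)) (by positivity : 0 ≤ 2 / b)
  have h0 : 0 ≤ f z * ‖z‖ ^ 2 := mul_nonneg (hf.nonneg z) (by positivity)
  rw [Real.norm_of_nonneg h0]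
  refine le_trans (le_of_eq ?_) h
  field_simp

lemma IsP2.integrable_llr_gaussianRef_iff {μ : Measure (Euc d)} (hμ : IsP2 μ) (hb : 0 < b)
    (hac : μ ≪ volume) :
    Integrable (llr μ (gaussianRef d b)) μ ↔ Integrable (llr μ volume) μ := by
  have := hμ.1
  have hint : Integrable (fun z : Euc d => -(-b * ‖z‖ ^ 2)
      + Real.log (∫ z : Euc d, rexp (-b * ‖z‖ ^ 2))) μ :=
    (hμ.2.const_mul (-b)).neg.add (integrable_const _)
  rw [gaussianRef, integrable_congr (llr_tilted_right hac (integrable_exp_neg_mul_norm_sq hb))]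
  exact integrable_add_iff_integrable_right hint

end GaussianReference

section StageOne

variable {da dw dx dz : ℕ} {ρ : Measure (Euc da × Euc dw × ℝ)} {ΨA : Euc da → Euc dx → ℝ}
  {ΨW : Euc dw → Euc dz → ℝ} {ζ σ b : ℝ} {μx : Measure (Euc dx)} {μ : Measure (Euc dz)}

/-- The Stage-I risk as a function of the density of `μz` with respect to `γ`. -/
def stageOneRisk (ρ : Measure (Euc da × Euc dw × ℝ)) (ΨA : Euc da → Euc dx → ℝ)
    (ΨW : Euc dw → Euc dz → ℝ) (μx : Measure (Euc dx)) (γ : Measure (Euc dz)) :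
    (Euc dz → ℝ) → ℝ :=
  quadRisk ρ γ (fun p z => ΨW p.2.1 z) fun p => ∫ x, ΨA p.1 x ∂μx

lemma U1_eq_stageOneRisk {γ : Measure (Euc dz)} [SigmaFinite γ] [SigmaFinite μ] (h : μ ≪ γ) :
    U1 ρ ΨA ΨW μx μ = stageOneRisk ρ ΨA ΨW μx γ fun z => (μ.rnDeriv γ z).toReal := by
  simp only [U1, stageOneRisk, quadRisk, ← smul_eq_mul, integral_rnDeriv_smul h]

lemma absolutelyContinuous_and_integrable_of_calF1_ne_top (hσ : 0 < σ)
    (h : calF1 ρ ΨA ΨW ζ σ μx μ ≠ ⊤) : μ ≪ volume ∧ Integrable (llr μ volume) μ := by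
  by_contra hn
  rw [llr_def] at hn
  refine h ?_
  rw [calF1, Ent, if_neg hn, EReal.coe_mul_top_of_pos hσ, EReal.coe_add_top]

lemma calF1_eq_entropicObjective (hb : 0 < b) (hbσ : σ * b = ζ / 2) (hμ : IsP2 μ)
    (hac : μ ≪ volume) (hint : Integrable (llr μ volume) μ) :
    calF1 ρ ΨA ΨW ζ σ μx μ
      = ((entropicObjective (gaussianRef dz b) (stageOneRisk ρ ΨA ΨW μx (gaussianRef dz b)) σ
          (fun z => (μ.rnDeriv (gaussianRef dz b) z).toReal)
        - σ * Real.log (∫ z : Euc dz, rexp (-b * ‖z‖ ^ 2)) : ℝ) : EReal) := by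
  have := hμ.1
  have := isProbabilityMeasure_gaussianRef (d := dz) hb
  have hacγ := hac.trans (volume_absolutelyContinuous_gaussianRef hb)
  have hintγ := (hμ.integrable_llr_gaussianRef_iff hb hac).2 hint
  have hllr : ∫ z, llr μ (gaussianRef dz b) z ∂μ = ∫ z, llr μ volume z ∂μ
      + b * ∫ z, ‖z‖ ^ 2 ∂μ + Real.log (∫ z : Euc dz, rexp (-b * ‖z‖ ^ 2)) := by
    rw [gaussianRef, integral_llr_tilted_right hac (hμ.2.const_mul (-b))
      (integrable_exp_neg_mul_norm_sq hb) hint, integral_const_mul]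
    ring
  rw [calF1, Ent, if_pos ⟨hac, hint⟩, ← EReal.coe_mul, ← EReal.coe_add, EReal.coe_eq_coe_iff,
    F1, U1_eq_stageOneRisk hacγ, entropicObjective, integral_klFun_rnDeriv hacγ hintγ, hllr,
    probReal_univ, probReal_univ, ← hbσ, llr_def]
  ring

end StageOne

/-- Proposition 4.3, Stage I: existence, uniqueness, finiteness of value
and absolute continuity of the Stage-I minimizer. -/
theorem stmt7
    {da dw dx dz : ℕ} (hda : 0 < da) (hdw : 0 < dw) (hdx : 0 < dx) (hdz : 0 < dz)
    (R M ζ1 σ1 : ℝ) (hR : 0 < R) (hM : 0 < M) (hζ1 : 0 < ζ1) (hσ1 : 0 < σ1)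
    (ρ : Measure (Euc da × Euc dw × ℝ)) (hρ : IsProbabilityMeasure ρ)
    (ΨA : Euc da → Euc dx → ℝ) (ΨW : Euc dw → Euc dz → ℝ)
    (hA1 : A1 ρ M) (hA2 : A2 ΨA ΨW R)
    (μx : Measure (Euc dx)) (hμx : IsP2 μx) :
    ∃ μzs : Measure (Euc dz), IsP2 μzs ∧
      (∀ ν, IsP2 ν → calF1 ρ ΨA ΨW ζ1 σ1 μx μzs ≤ calF1 ρ ΨA ΨW ζ1 σ1 μx ν) ∧
      calF1 ρ ΨA ΨW ζ1 σ1 μx μzs ≠ ⊤ ∧ calF1 ρ ΨA ΨW ζ1 σ1 μx μzs ≠ ⊥ ∧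
      μzs ≪ (volume : Measure (Euc dz)) ∧
      (∀ μz' : Measure (Euc dz), IsP2 μz' →
        (∀ ν, IsP2 ν → calF1 ρ ΨA ΨW ζ1 σ1 μx μz' ≤ calF1 ρ ΨA ΨW ζ1 σ1 μx ν) →
        μz' = μzs) := by
  obtain ⟨-, hΨW, hΨAR, hΨWR, -⟩ := id hA2
  have hΨA := hA2.1
  have hμxp := hμx.1
  set b : ℝ := ζ1 / (2 * σ1) with hb_def
  have hb : 0 < b := by positivity
  have hbσ : σ1 * b = ζ1 / 2 := by
    rw [hb_def]
    field_simp
  set γ := gaussianRef dz b with hγ_def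
  have hγ : IsProbabilityMeasure γ := isProbabilityMeasure_gaussianRef hb
  set V := stageOneRisk ρ ΨA ΨW μx γ with hV_def
  have hΨ : Measurable (Function.uncurry fun (p : Euc da × Euc dw × ℝ) z => ΨW p.2.1 z) :=
    hΨW.comp (by fun_prop : Measurable fun q : (Euc da × Euc dw × ℝ) × Euc dz => (q.1.2.1, q.2))
  have hc : Measurable fun p : Euc da × Euc dw × ℝ => ∫ x, ΨA p.1 x ∂μx :=
    (StronglyMeasurable.integral_prod_right hΨA.stronglyMeasurable).measurable.comp measurable_fst
  have hcR : ∀ p : Euc da × Euc dw × ℝ, |∫ x, ΨA p.1 x ∂μx| ≤ R := fun p => by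
    simpa using norm_integral_le_of_norm_le_const (μ := μx) (f := ΨA p.1) (C := R) (.of_forall fun x => hΨAR p.1 x)
  have hVmid : ∀ f g, IsProbDensity γ f → IsProbDensity γ g →
      2 * V (fun x => (f x + g x) / 2) ≤ V f + V g := fun f g hf hg =>
    two_mul_quadRisk_midpoint_le hΨ (fun p z => hΨWR _ z) hc hcR hf hg
  obtain ⟨f, hf, hfi, hmin⟩ := exists_entropicObjective_minimizer (γ := γ) (V := V) hσ1
    quadRisk_nonneg hVmid
    fun f g hf hg => abs_quadRisk_sub_le hΨ (fun p z => hΨWR _ z) hc hcR hf hg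
  have hJ : ∀ ν, IsP2 ν → ν ≪ volume → Integrable (llr ν volume) ν →
      entropicObjective γ V σ1 f
        ≤ entropicObjective γ V σ1 fun z => (ν.rnDeriv γ z).toReal := fun ν hν hac hint => by
    have := hν.1
    have hacγ := hac.trans (volume_absolutelyContinuous_gaussianRef hb)
    exact hmin _ (isProbDensity_toReal_rnDeriv hacγ) ((integrable_klFun_rnDeriv_iff hacγ).2
      ((hν.integrable_llr_gaussianRef_iff hb hac).2 hint))
  set μs := γ.withDensity fun z => ENNReal.ofReal (f z) with hμs_def
  have hμsp : IsProbabilityMeasure μs := hf.isProbabilityMeasure_withDensity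
  have hfs : (fun z => (μs.rnDeriv γ z).toReal) =ᵐ[γ] f := hf.toReal_rnDeriv_withDensity
  have hμsγ : μs ≪ γ := withDensity_absolutelyContinuous _ _
  have hμsac : μs ≪ volume := hμsγ.trans gaussianRef_absolutelyContinuous_volume
  have hμs2 : IsP2 μs := by
    refine ⟨hμsp, ?_⟩
    have := Measure.haveLebesgueDecomposition_of_sigmaFinite μs γ
    rw [← integrable_rnDeriv_smul_iff hμsγ]
    refine (hf.integrable_mul_norm_sq hb hfi).congr ?_
    filter_upwards [hfs] with z hz
    rw [smul_eq_mul, hz]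
  have hμsint : Integrable (llr μs volume) μs := by
    rw [← hμs2.integrable_llr_gaussianRef_iff hb hμsac, ← integrable_klFun_rnDeriv_iff hμsγ]
    refine hfi.congr ?_
    filter_upwards [hfs] with z hz
    rw [hz]
  have hJs : entropicObjective γ V σ1 (fun z => (μs.rnDeriv γ z).toReal)
      = entropicObjective γ V σ1 f := by
    rw [entropicObjective, entropicObjective, hV_def, stageOneRisk, quadRisk_congr hfs]
    congr 2
    refine integral_congr_ae ?_
    filter_upwards [hfs] with z hz
    rw [hz]
  have hval := calF1_eq_entropicObjective (ρ := ρ) (ΨA := ΨA) (ΨW := ΨW) (μx := μx) hb hbσ hμs2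
    hμsac hμsint
  rw [← hγ_def, ← hV_def, hJs] at hval
  refine ⟨μs, hμs2, fun ν hν => ?_, hval ▸ EReal.coe_ne_top _, hval ▸ EReal.coe_ne_bot _, hμsac,
    fun μ' hμ' hμ'min => ?_⟩
  · by_cases htop : calF1 ρ ΨA ΨW ζ1 σ1 μx ν = ⊤
    · rw [htop]
      exact le_top
    obtain ⟨hac, hint⟩ := absolutelyContinuous_and_integrable_of_calF1_ne_top hσ1 htop
    rw [hval, calF1_eq_entropicObjective hb hbσ hν hac hint, EReal.coe_le_coe_iff]
    exact sub_le_sub_right (hJ ν hν hac hint) _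
  · have hle := hμ'min μs hμs2
    rw [hval] at hle
    obtain ⟨hac, hint⟩ := absolutelyContinuous_and_integrable_of_calF1_ne_top hσ1
      (hle.trans_lt (EReal.coe_lt_top _)).ne
    rw [calF1_eq_entropicObjective hb hbσ hμ' hac hint, EReal.coe_le_coe_iff,
      sub_le_sub_iff_right] at hle
    have hμ'p := hμ'.1
    have hacγ : μ' ≪ γ := hac.trans (volume_absolutelyContinuous_gaussianRef hb)
    have hf' : IsProbDensity γ fun z => (μ'.rnDeriv γ z).toReal :=
      isProbDensity_toReal_rnDeriv hacγ
    have hfi' : Integrable (fun z => klFun (μ'.rnDeriv γ z).toReal) γ :=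
      (integrable_klFun_rnDeriv_iff hacγ).2
        ((hμ'.integrable_llr_gaussianRef_iff hb hac).2 hint)
    exact eq_of_toReal_rnDeriv_ae_eq hacγ hμsγ
      ((hf'.ae_eq_of_minimizers hσ1 hVmid hmin hf hfi' hfi hle le_rfl).trans hfs.symm)
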